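/- arXiv:1507.01322 — 2 statements merged into one kernel-verified Lean document; each statement's English description precedes it below -/
import Mathlib

section
/- A head start can be truncated to the longest overlap: for patterns S and W, the head-start first-occurrence time of S given the full string W has the same distribution as the head-start first-occurrence time of S given the string W⊓S, i.e. μ(T_{S|W} = n) = μ(T_{S|W⊓S} = n) for all n ≥ 1. -/
open MeasureTheory ENNReal

def occursAt (S : List Bool) (ω : ℕ → Bool) (n : ℕ) : Prop :=
  S.length ≤ n ∧ ∀ j < S.length, ω (n - S.length + j) = S.getD j false

/-- The concatenated sequence `C ⌢ ω`. -/
def catSeq (C : List Bool) (ω : ℕ → Bool) : ℕ → Bool :=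
  fun i => if i < C.length then C.getD i false else ω (i - C.length)

/-- The head-start first-occurrence time `T_{S|C}`. -/
noncomputable def headOcc (S C : List Bool) (ω : ℕ → Bool) : ℕ∞ :=
  ⨅ (n : ℕ) (_ : 1 ≤ n ∧ occursAt S (catSeq C ω) (C.length + n)), (n : ℕ∞)

/-- The overlap set `W ⊡ S`. -/
def overlaps (W S : List Bool) : Finset ℕ :=
  (Finset.Icc 1 (min W.length S.length)).filter fun i => W.drop (W.length - i) = S.take i

/-- `W ⊛ S`: the largest overlap shift (0 if there is none). -/
def maxOverlap (W S : List Bool) : ℕ := (overlaps W S).sup id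

/-- `W ⊓ S`: the prefix of `S` of length `W ⊛ S`. -/
def sqcap (W S : List Bool) : List Bool := S.take (maxOverlap W S)

theorem catSeq_append (D C : List Bool) (ω : ℕ → Bool) (i : ℕ) :
    catSeq (D ++ C) ω (D.length + i) = catSeq C ω i := by
  simp [catSeq, List.getD_eq_getElem?_getD, List.getElem?_append_right, Nat.add_sub_add_left]

theorem mem_overlaps_of_occursAt {S W : List Bool} {ω : ℕ → Bool} {n : ℕ}
    (hnS : n < S.length) (hn : 1 ≤ n) (h : occursAt S (catSeq W ω) (W.length + n)) :
    S.length - n ∈ overlaps W S := by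
  obtain ⟨hl, h⟩ := h
  simp only [overlaps, Finset.mem_filter, Finset.mem_Icc]
  refine ⟨by omega, List.ext_getElem (by simp; omega) fun j hj _ => ?_⟩
  rw [List.length_drop] at hj
  have hjS : j < S.length := by omega
  have hjW : W.length + n - S.length + j < W.length := by omega
  have hidx : W.length - (S.length - n) + j = W.length + n - S.length + j := by omega
  have := h j hjS
  rw [catSeq, if_pos hjW, List.getD_eq_getElem _ _ hjW, List.getD_eq_getElem _ _ hjS] at this
  simpa [hidx] using this

theorem maxOverlap_le (W S : List Bool) : maxOverlap W S ≤ min W.length S.length :=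
  Finset.sup_le fun _ hi => (Finset.mem_Icc.mp (Finset.mem_filter.mp hi).1).2

theorem length_sqcap (W S : List Bool) : (sqcap W S).length = maxOverlap W S := by
  have := maxOverlap_le W S
  simp only [sqcap, List.length_take]
  omega

theorem drop_eq_sqcap (W S : List Bool) : W.drop (W.length - maxOverlap W S) = sqcap W S := by
  obtain h | h := (overlaps W S).eq_empty_or_nonempty
  · simp [sqcap, maxOverlap, h]
  · obtain ⟨i, hi, hmax⟩ := Finset.exists_mem_eq_sup _ h id
    have hM : maxOverlap W S = i := hmax
    rw [sqcap, hM]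
    exact (Finset.mem_filter.mp hi).2

theorem sqcap_suffix (W S : List Bool) : sqcap W S <:+ W :=
  drop_eq_sqcap W S ▸ List.drop_suffix _ _

theorem occursAt_catSeq_sqcap (S W : List Bool) (ω : ℕ → Bool) {n : ℕ} (hn : 1 ≤ n) :
    occursAt S (catSeq W ω) (W.length + n) ↔
      occursAt S (catSeq (sqcap W S) ω) ((sqcap W S).length + n) := by
  by_cases hlen : S.length ≤ (sqcap W S).length + n
  · obtain ⟨D, hD⟩ := sqcap_suffix W S
    generalize sqcap W S = C at hD hlen
    subst hD
    have hidx (j : ℕ) : (D ++ C).length + n - S.length + j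
        = D.length + (C.length + n - S.length + j) := by
      rw [List.length_append]
      omega
    have hlen' : S.length ≤ (D ++ C).length + n := by
      rw [List.length_append]
      omega
    simp only [occursAt, hidx, catSeq_append, hlen, hlen', true_and]
  · refine iff_of_false (fun h => ?_) fun h => hlen h.1
    have hle : S.length - n ≤ maxOverlap W S :=
      Finset.le_sup (f := id) (mem_overlaps_of_occursAt (by omega) hn h)
    rw [length_sqcap] at hlen
    omega

/-- Truncating the head start to the longest overlap does not change the first-occurrence time,
sequence by sequence. -/
theorem headOcc_sqcap (S W : List Bool) (ω : ℕ → Bool) :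
    headOcc S (sqcap W S) ω = headOcc S W ω := by
  unfold headOcc
  refine iInf_congr fun n => iInf_congr_Prop ?_ fun _ => rfl
  exact and_congr_right fun hn => (occursAt_catSeq_sqcap S W ω hn).symm

theorem stmt8 (p : ℝ) (hp0 : 0 < p) (hp1 : p < 1)
    (μ : Measure (ℕ → Bool)) [IsProbabilityMeasure μ]
    (hμ : ∀ (n : ℕ) (b : ℕ → Bool),
      μ {ω | ∀ i < n, ω i = b i}
        = ∏ i ∈ Finset.range n, (if b i then ENNReal.ofReal p else ENNReal.ofReal (1 - p)))
    (S W : List Bool) (hS : S ≠ []) (hW : W ≠ []) (hsub : ¬ S <:+: W)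
    (n : ℕ) (hn : 1 ≤ n) :
    μ {ω | headOcc S W ω = (n : ℕ∞)} = μ {ω | headOcc S (sqcap W S) ω = (n : ℕ∞)} := by
  simp only [headOcc_sqcap]
end

section
/- For each pattern index i and every real z with 0 < z < 1: Σ_{j=1}^{m} X_j(z) / F_{S_j⊓S_i}(z) = 1, where F_C(z) is the first-occurrence generating function of the string C (with F_∅(z) := 1 for the empty string). -/
open MeasureTheory ENNReal

noncomputable def firstOcc (S : List Bool) (ω : ℕ → Bool) : ℕ∞ :=
  ⨅ (n : ℕ) (_ : occursAt S ω n), (n : ℕ∞)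

noncomputable def f (μ : Measure (ℕ → Bool)) (S : List Bool) (n : ℕ) : ℝ≥0∞ :=
  μ {ω | firstOcc S ω = (n : ℕ∞)}

/-- The first-occurrence generating function `F_S(z) = ∑ μ(T_S = n) zⁿ`.
For the empty string, `T_∅ = 0` everywhere, so `F_∅(z) = 1`. -/
noncomputable def F (μ : Measure (ℕ → Bool)) (S : List Bool) (z : ℝ) : ℝ :=
  ∑' n : ℕ, (f μ S n).toReal * z ^ n

/-- Pattern `i` wins the game at trial `n`. -/
def winsAt {m : ℕ} (S : Fin m → List Bool) (i : Fin m) (ω : ℕ → Bool) (n : ℕ) : Prop :=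
  occursAt (S i) ω n ∧ ∀ j : Fin m, ∀ l < n, ¬ occursAt (S j) ω l

noncomputable def x {m : ℕ} (μ : Measure (ℕ → Bool)) (S : Fin m → List Bool)
    (i : Fin m) (n : ℕ) : ℝ≥0∞ :=
  μ {ω | winsAt S i ω n}

/-- The generating function `X_i(z) = ∑ x_{i,n} zⁿ`. -/
noncomputable def X {m : ℕ} (μ : Measure (ℕ → Bool)) (S : Fin m → List Bool)
    (i : Fin m) (z : ℝ) : ℝ :=
  ∑' n : ℕ, (x μ S i n).toReal * z ^ n

/-- The word formed by the outcomes of the first `n` trials. -/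
def initialWord (ω : ℕ → Bool) (n : ℕ) : List Bool := (List.range n).map ω

@[simp]
theorem length_initialWord (ω : ℕ → Bool) (n : ℕ) : (initialWord ω n).length = n := by
  simp [initialWord]

theorem take_initialWord (ω : ℕ → Bool) {l n : ℕ} (h : l ≤ n) :
    (initialWord ω n).take l = initialWord ω l := by
  simp [initialWord, ← List.map_take, List.take_range, h]

theorem occursAt_iff_suffix (S : List Bool) (ω : ℕ → Bool) (n : ℕ) :
    occursAt S ω n ↔ S <:+ initialWord ω n := by
  rw [List.suffix_iff_eq_drop]
  constructor
  · rintro ⟨hle, h⟩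
    apply List.ext_getElem
    · simp; omega
    · intro j h1 h2
      have := h j h1
      simp [initialWord, this, h1]
  · intro h
    have hlen := congrArg List.length h
    simp only [List.length_drop, length_initialWord] at hlen
    refine ⟨by omega, fun j hj => ?_⟩
    have : S.getD j false = S[j] := by simp [hj]
    rw [this]
    have h2 : S[j]? = ((initialWord ω n).drop ((initialWord ω n).length - S.length))[j]? := by
      rw [← h]
    have h3 : n - S.length + j < n := by omega
    simp [initialWord, hj, h3] at h2
    exact h2.symm

theorem initialWord_eq_append {ω : ℕ → Bool} {n : ℕ} {T : List Bool}
    (h : T <:+ initialWord ω (n + T.length)) :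
    initialWord ω (n + T.length) = initialWord ω n ++ T := by
  obtain ⟨U, hU⟩ := h
  have hlen := congrArg List.length hU
  simp only [List.length_append, length_initialWord] at hlen
  rw [← take_initialWord ω (Nat.le_add_right n T.length), ← hU]
  simp [show n = U.length by omega]

/-- The product of the weights of the letters of a word. -/
noncomputable def wordWeight (p : ℝ) (S : List Bool) : ℝ :=
  (S.map fun b => if b then p else 1 - p).prod

theorem wordWeight_append (p : ℝ) (S T : List Bool) :
    wordWeight p (S ++ T) = wordWeight p S * wordWeight p T := by
  simp [wordWeight]

theorem wordWeight_pos {p : ℝ} (hp0 : 0 < p) (hp1 : p < 1) (S : List Bool) :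
    0 < wordWeight p S := by
  apply List.prod_pos
  intro a ha
  obtain ⟨b, -, rfl⟩ := List.mem_map.1 ha
  split_ifs <;> linarith

theorem wordWeight_initialWord (p : ℝ) (b : ℕ → Bool) (n : ℕ) :
    wordWeight p (initialWord b n) = ∏ i ∈ Finset.range n, if b i then p else 1 - p := by
  induction n with
  | zero => simp [wordWeight, initialWord]
  | succ n ih =>
    rw [Finset.prod_range_succ, ← ih]
    simp [wordWeight, initialWord, List.range_succ]

theorem initialWord_congr {ω ω' : ℕ → Bool} {n : ℕ} :
    initialWord ω n = initialWord ω' n ↔ ∀ i < n, ω i = ω' i := by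
  simp [initialWord]

/-- The event `A` is determined by the first `n` trials. -/
def DeterminedBy (A : Set (ℕ → Bool)) (n : ℕ) : Prop :=
  ∀ ω ω', initialWord ω n = initialWord ω' n → ω ∈ A → ω' ∈ A

theorem DeterminedBy.measurableSet {A : Set (ℕ → Bool)} {n : ℕ} (hA : DeterminedBy A n) :
    MeasurableSet A := by
  let π : (ℕ → Bool) → (Fin n → Bool) := fun ω i => ω i
  have hπ : Measurable π := by fun_prop
  have : A = π ⁻¹' (π '' A) := by
    refine Set.Subset.antisymm (Set.subset_preimage_image _ _) ?_
    rintro ω ⟨ω', h, hω⟩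
    exact hA ω' ω (initialWord_congr.2 fun i hi => congrFun hω ⟨i, hi⟩) h
  rw [this]
  exact hπ (Set.toFinite _).measurableSet

section Independence

variable {p : ℝ} {μ : Measure (ℕ → Bool)}

theorem measureReal_initialWord_eq (hp0 : 0 < p) (hp1 : p < 1)
    (hμ : ∀ (n : ℕ) (b : ℕ → Bool),
      μ {ω | ∀ i < n, ω i = b i}
        = ∏ i ∈ Finset.range n, (if b i then ENNReal.ofReal p else ENNReal.ofReal (1 - p)))
    (U : List Bool) :
    μ.real {ω | initialWord ω U.length = U} = wordWeight p U := by
  have hU : initialWord (fun i => U.getD i false) U.length = U := by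
    apply List.ext_getElem
    · simp
    · intro i h1 h2
      simp [initialWord, h2]
  have hset : {ω | initialWord ω U.length = U} =
      {ω | ∀ i < U.length, ω i = U.getD i false} := by
    ext ω
    rw [Set.mem_ofPred_eq, Set.mem_ofPred_eq]
    conv_lhs => rw [← hU, length_initialWord]
    exact initialWord_congr
  rw [hset, Measure.real, hμ U.length fun i => U.getD i false, ENNReal.toReal_prod]
  conv_rhs => rw [← hU, wordWeight_initialWord]
  refine Finset.prod_congr rfl fun i _ => ?_
  split_ifs <;> exact ENNReal.toReal_ofReal (by linarith)

theorem measureReal_eq_sum_words [IsFiniteMeasure μ] (n : ℕ) (A : Set (ℕ → Bool)) :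
    μ.real A = ∑ v : Fin n → Bool, μ.real ({ω | initialWord ω n = List.ofFn v} ∩ A) := by
  let π : (ℕ → Bool) → (Fin n → Bool) := fun ω i => ω i
  have hπ : Measurable π := by fun_prop
  have key := sum_measureReal_preimage_singleton (μ := μ.restrict A) (f := π) Finset.univ
    (fun v _ => hπ (measurableSet_singleton v))
  simp only [Finset.coe_univ, Set.preimage_univ, measureReal_restrict_apply_univ] at key
  rw [← key]
  refine Finset.sum_congr rfl fun v _ => ?_
  rw [measureReal_restrict_apply (hπ (measurableSet_singleton v))]
  congr 2
  ext ω
  simp only [Set.mem_preimage, Set.mem_singleton_iff, Set.mem_ofPred_eq]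
  have : initialWord ω n = List.ofFn (π ω) := by
    apply List.ext_getElem <;> simp [initialWord, π]
  rw [this, List.ofFn_inj]

theorem measureReal_inter_occursAt [IsFiniteMeasure μ] (hp0 : 0 < p) (hp1 : p < 1)
    (hμ : ∀ (n : ℕ) (b : ℕ → Bool),
      μ {ω | ∀ i < n, ω i = b i}
        = ∏ i ∈ Finset.range n, (if b i then ENNReal.ofReal p else ENNReal.ofReal (1 - p)))
    {A : Set (ℕ → Bool)} {n : ℕ} (hA : DeterminedBy A n) (T : List Bool) :
    μ.real (A ∩ {ω | occursAt T ω (n + T.length)}) = μ.real A * wordWeight p T := by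
  rw [measureReal_eq_sum_words n A, measureReal_eq_sum_words n (A ∩ _), Finset.sum_mul]
  refine Finset.sum_congr rfl fun v _ => ?_
  by_cases hv : ∃ ω ∈ A, initialWord ω n = List.ofFn v
  · obtain ⟨ω₀, h₀, hω₀⟩ := hv
    have hsub : {ω | initialWord ω n = List.ofFn v} ⊆ A := fun ω hω =>
      hA ω₀ ω (hω₀.trans (Eq.symm hω)) h₀
    rw [Set.inter_eq_left.2 hsub, ← Set.inter_assoc, Set.inter_eq_left.2 hsub]
    have h1 := measureReal_initialWord_eq hp0 hp1 hμ (List.ofFn v)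
    have h2 := measureReal_initialWord_eq hp0 hp1 hμ (List.ofFn v ++ T)
    rw [List.length_ofFn] at h1
    rw [wordWeight_append, List.length_append, List.length_ofFn] at h2
    rw [h1, ← h2]
    congr 1
    ext ω
    simp only [Set.mem_inter_iff, Set.mem_ofPred_eq, occursAt_iff_suffix]
    constructor
    · rintro ⟨h, h'⟩
      rw [initialWord_eq_append h', h]
    · intro h
      refine ⟨?_, h ▸ List.suffix_append _ _⟩
      rw [← take_initialWord ω (Nat.le_add_right n T.length), h]
      simp
  · have h1 : {ω | initialWord ω n = List.ofFn v} ∩ A = ∅ := by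
      ext ω
      simp only [Set.mem_inter_iff, Set.mem_ofPred_eq, Set.mem_empty_iff_false, iff_false]
      exact fun h => hv ⟨ω, h.2, h.1⟩
    rw [← Set.inter_assoc, h1]
    simp

end Independence

theorem mem_overlaps {W S : List Bool} {k : ℕ} :
    k ∈ overlaps W S ↔
      1 ≤ k ∧ k ≤ W.length ∧ k ≤ S.length ∧ W.drop (W.length - k) = S.take k := by
  simp [overlaps, and_assoc]

theorem overlaps_sqcap_self (W S : List Bool) :
    overlaps (sqcap W S) (sqcap W S) = overlaps W S := by
  rcases (overlaps W S).eq_empty_or_nonempty with h | h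
  · have : sqcap W S = [] := by simp [sqcap, maxOverlap, h]
    rw [this, h]
    rfl
  · obtain ⟨c, hc, hcs⟩ := Finset.exists_mem_eq_sup _ h id
    have hmax : maxOverlap W S = c := hcs
    have hle : ∀ k ∈ overlaps W S, k ≤ c := fun k hk => hmax ▸ Finset.le_sup (f := id) hk
    obtain ⟨h1, hW, hS, hd⟩ := mem_overlaps.1 hc
    have hlen : (S.take c).length = c := by simp [hS]
    have hdrop : ∀ k ≤ c, (S.take c).drop (c - k) = W.drop (W.length - k) := by
      intro k hk
      rw [← hd, List.drop_drop]
      congr 1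
      omega
    have htake : ∀ k ≤ c, (S.take c).take k = S.take k := fun k hk => by
      rw [List.take_take, min_eq_left hk]
    ext k
    rw [sqcap, hmax, mem_overlaps, hlen]
    constructor
    · rintro ⟨a, b, -, d⟩
      rw [hdrop k b, htake k b] at d
      exact mem_overlaps.2 ⟨a, by omega, by omega, d⟩
    · intro hk
      have b := hle k hk
      obtain ⟨a, -, -, d⟩ := mem_overlaps.1 hk
      rw [hdrop k b, htake k b]
      exact ⟨a, b, b, d⟩

section Game

variable {m : ℕ} {S : Fin m → List Bool}

/-- The event that no pattern has occurred by trial `n`. -/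
def noneBy (S : Fin m → List Bool) (n : ℕ) : Set (ℕ → Bool) :=
  {ω | ∀ j, ∀ l ≤ n, ¬ occursAt (S j) ω l}

theorem occursAt_congr {T : List Bool} {ω ω' : ℕ → Bool} {l n : ℕ}
    (h : initialWord ω n = initialWord ω' n) (hl : l ≤ n) :
    occursAt T ω l ↔ occursAt T ω' l := by
  rw [occursAt_iff_suffix, occursAt_iff_suffix, ← take_initialWord ω hl,
    ← take_initialWord ω' hl, h]

theorem determinedBy_noneBy (S : Fin m → List Bool) (n : ℕ) : DeterminedBy (noneBy S n) n :=
  fun _ _ h hω j l hl ho => hω j l hl ((occursAt_congr h hl).2 ho)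

theorem determinedBy_winsAt (S : Fin m → List Bool) (j : Fin m) (n : ℕ) :
    DeterminedBy {ω | winsAt S j ω n} n :=
  fun _ _ h hω => ⟨(occursAt_congr h le_rfl).1 hω.1, fun j l hl ho =>
    hω.2 j l hl ((occursAt_congr h hl.le).2 ho)⟩

theorem determinedBy_occursAt (T : List Bool) (n : ℕ) :
    DeterminedBy {ω | occursAt T ω n} n :=
  fun _ _ h hω => (occursAt_congr h le_rfl).1 hω

theorem winsAt_unique (hsub : ∀ i j, i ≠ j → ¬ S i <:+: S j) {ω : ℕ → Bool} {i j : Fin m}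
    {k l : ℕ} (hi : winsAt S i ω k) (hj : winsAt S j ω l) : k = l ∧ i = j := by
  have hkl : k = l := by
    rcases lt_trichotomy k l with h | h | h
    · exact absurd hi.1 (hj.2 i k h)
    · exact h
    · exact absurd hj.1 (hi.2 j l h)
  subst hkl
  refine ⟨rfl, by_contra fun hne => ?_⟩
  have h1 := (occursAt_iff_suffix _ _ _).1 hi.1
  have h2 := (occursAt_iff_suffix _ _ _).1 hj.1
  rcases le_total (S i).length (S j).length with h | h
  · exact hsub i j hne (List.suffix_of_suffix_length_le h1 h2 h).isInfix
  · exact hsub j i (Ne.symm hne) (List.suffix_of_suffix_length_le h2 h1 h).isInfix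

theorem noneBy_inter_occursAt_eq (hsub : ∀ i j, i ≠ j → ¬ S i <:+: S j) (i : Fin m)
    (n : ℕ) :
    noneBy S n ∩ {ω | occursAt (S i) ω (n + (S i).length)} =
      ⋃ a ∈ Finset.univ.sigma fun j => overlaps (S j) (S i),
        {ω | winsAt S a.1 ω (n + a.2)} ∩
          {ω | occursAt ((S i).drop a.2) ω (n + (S i).length)} := by
  classical
  ext ω
  simp only [Set.mem_inter_iff, Set.mem_ofPred_eq, Set.mem_iUnion, Finset.mem_sigma,
    Finset.mem_univ, true_and, exists_prop, Sigma.exists]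
  constructor
  · rintro ⟨hnone, hocc⟩
    have hex : ∃ l, ∃ j, occursAt (S j) ω l := ⟨_, i, hocc⟩
    obtain ⟨j, hj⟩ := Nat.find_spec hex
    have hmin : ∀ j, ∀ l < Nat.find hex, ¬ occursAt (S j) ω l := fun j l hl ho =>
      Nat.find_min hex hl ⟨j, ho⟩
    have hle : Nat.find hex ≤ n + (S i).length := Nat.find_min' hex ⟨i, hocc⟩
    have hlt : n < Nat.find hex := by
      by_contra h
      exact hnone j _ (not_lt.1 h) hj
    obtain ⟨r, hr⟩ := Nat.exists_eq_add_of_lt hlt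
    rw [add_assoc] at hr
    rw [hr] at hj hmin hle
    have hocc' := (occursAt_iff_suffix _ _ _).1 hocc
    have happ := initialWord_eq_append hocc'
    have hr' : initialWord ω (n + (r + 1)) = initialWord ω n ++ (S i).take (r + 1) := by
      rw [← take_initialWord ω hle, happ, List.take_append]
      simp
    have hjs := (occursAt_iff_suffix _ _ _).1 hj
    have htake : (S i).take (r + 1) <:+ initialWord ω (n + (r + 1)) :=
      hr' ▸ List.suffix_append _ _
    have hlen : ((S i).take (r + 1)).length = r + 1 := by
      rw [List.length_take]; omega
    have hrj : r + 1 ≤ (S j).length := by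
      by_contra hlt
      have hin : S j <:+: S i :=
        (List.suffix_of_suffix_length_le hjs htake (by omega)).isInfix.trans
          (List.take_prefix _ _).isInfix
      have : j = i := by_contra fun hne => hsub j i hne hin
      subst this
      omega
    refine ⟨j, r + 1, mem_overlaps.2 ⟨by omega, hrj, by omega, ?_⟩, ⟨hj, hmin⟩, ?_⟩
    · have := List.suffix_iff_eq_drop.1
        (List.suffix_of_suffix_length_le htake hjs (by omega))
      rw [hlen] at this
      exact this.symm
    · exact (occursAt_iff_suffix _ _ _).2 ((List.drop_suffix _ _).trans hocc')
  · rintro ⟨j, r, hr, hw, hd⟩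
    obtain ⟨h1, hj, hi', hov⟩ := mem_overlaps.1 hr
    refine ⟨fun j' l hl => hw.2 j' l (by omega), ?_⟩
    rw [occursAt_iff_suffix] at hd ⊢
    have hlen : n + (S i).length = n + r + ((S i).drop r).length := by
      rw [List.length_drop]; omega
    rw [hlen] at hd ⊢
    rw [initialWord_eq_append hd]
    have hsuf : (S i).take r <:+ initialWord ω (n + r) :=
      (hov ▸ List.drop_suffix _ _).trans ((occursAt_iff_suffix _ _ _).1 hw.1)
    obtain ⟨U, hU⟩ := hsuf
    refine ⟨U, ?_⟩
    rw [← hU, List.append_assoc, List.take_append_drop]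

theorem noneBy_eq_union (n : ℕ) :
    noneBy S n = noneBy S (n + 1) ∪ ⋃ j ∈ Finset.univ, {ω | winsAt S j ω (n + 1)} := by
  ext ω
  simp only [Set.mem_union, Set.mem_iUnion, Finset.mem_univ, exists_prop, true_and,
    Set.mem_ofPred_eq]
  constructor
  · intro h
    by_cases hj : ∃ j, occursAt (S j) ω (n + 1)
    · obtain ⟨j, hj⟩ := hj
      exact Or.inr ⟨j, hj, fun j' l hl => h j' l (by omega)⟩
    · refine Or.inl fun j l hl ho => ?_
      rcases Nat.lt_or_ge n l with h' | h'
      · obtain rfl : l = n + 1 := by omega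
        exact hj ⟨j, ho⟩
      · exact h j l h' ho
  · rintro (h | ⟨j, hj⟩)
    · exact fun j l hl => h j l (by omega)
    · exact fun j' l hl => hj.2 j' l (by omega)

variable {μ : Measure (ℕ → Bool)} [IsProbabilityMeasure μ] {p z : ℝ}

theorem summable_measureReal_mul_pow (A : ℕ → Set (ℕ → Bool)) (hz0 : 0 < z) (hz1 : z < 1) :
    Summable fun n => μ.real (A n) * z ^ n := by
  refine Summable.of_nonneg_of_le (fun n => by positivity) (fun n => ?_)
    (summable_geometric_of_lt_one hz0.le hz1)
  exact mul_le_of_le_one_left (by positivity) measureReal_le_one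

theorem measureReal_noneBy (hsub : ∀ i j, i ≠ j → ¬ S i <:+: S j) (n : ℕ) :
    μ.real (noneBy S n) =
      μ.real (noneBy S (n + 1)) + ∑ j, μ.real {ω | winsAt S j ω (n + 1)} := by
  have hmeas : ∀ j, MeasurableSet {ω | winsAt S j ω (n + 1)} := fun j =>
    (determinedBy_winsAt S j _).measurableSet
  rw [noneBy_eq_union n,
    measureReal_union _ (Finset.measurableSet_biUnion _ fun j _ => hmeas j)
      (measure_ne_top _ _) (measure_ne_top _ _),
    measureReal_biUnion_finset _ fun j _ => hmeas j]
  · intro j _ j' _ hne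
    exact Set.disjoint_left.2 fun ω h h' => hne (winsAt_unique hsub h h').2
  · refine Set.disjoint_left.2 fun ω h h' => ?_
    simp only [Set.mem_iUnion, Finset.mem_univ, exists_prop, true_and] at h'
    obtain ⟨j, hj⟩ := h'
    exact h j _ le_rfl hj.1

theorem sum_X_add_eq_one (hS : ∀ i, S i ≠ []) (hsub : ∀ i j, i ≠ j → ¬ S i <:+: S j)
    (hz0 : 0 < z) (hz1 : z < 1) :
    ∑ j, X μ S j z + (1 - z) * ∑' n, μ.real (noneBy S n) * z ^ n = 1 := by
  have hG := summable_measureReal_mul_pow (μ := μ) (noneBy S) hz0 hz1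
  have hX : ∀ j, Summable fun n => μ.real {ω | winsAt S j ω n} * z ^ n := fun j =>
    summable_measureReal_mul_pow (fun n => {ω | winsAt S j ω n}) hz0 hz1
  have hX1 : ∀ j, X μ S j z = ∑' n, μ.real {ω | winsAt S j ω (n + 1)} * z ^ (n + 1) := by
    intro j
    have h0 : {ω | winsAt S j ω 0} = ∅ := by
      ext ω
      simp only [Set.mem_ofPred_eq, Set.mem_empty_iff_false, iff_false]
      rintro ⟨⟨h, -⟩, -⟩
      exact hS j (List.length_eq_zero_iff.1 (Nat.le_zero.1 h))
    have : X μ S j z = ∑' n, μ.real {ω | winsAt S j ω n} * z ^ n := rfl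
    rw [this, (hX j).tsum_eq_zero_add, h0]
    simp
  have hG0 : noneBy S 0 = Set.univ := by
    ext ω
    simp only [Set.mem_univ, iff_true]
    rintro j l hl ⟨h, -⟩
    exact hS j (List.length_eq_zero_iff.1 (by omega))
  have hsum : ∑ j, X μ S j z =
      z * ∑' n, μ.real (noneBy S n) * z ^ n -
        ∑' n, μ.real (noneBy S (n + 1)) * z ^ (n + 1) := by
    simp_rw [hX1]
    rw [← Summable.tsum_finsetSum fun j _ => (summable_nat_add_iff 1).2 (hX j),
      ← tsum_mul_left,
      ← (hG.mul_left z).tsum_sub ((summable_nat_add_iff 1).2 hG)]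
    refine tsum_congr fun n => ?_
    rw [measureReal_noneBy hsub n, ← Finset.sum_mul]
    ring
  have hG1 := hG.tsum_eq_zero_add
  rw [hG0] at hG1
  simp only [probReal_univ, pow_zero, mul_one] at hG1
  rw [hsum]
  linarith

theorem measureReal_noneBy_mul (hp0 : 0 < p) (hp1 : p < 1)
    (hμ : ∀ (n : ℕ) (b : ℕ → Bool),
      μ {ω | ∀ i < n, ω i = b i}
        = ∏ i ∈ Finset.range n, (if b i then ENNReal.ofReal p else ENNReal.ofReal (1 - p)))
    (hsub : ∀ i j, i ≠ j → ¬ S i <:+: S j) (i : Fin m) (n : ℕ) :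
    μ.real (noneBy S n) * wordWeight p (S i) =
      ∑ j, ∑ r ∈ overlaps (S j) (S i),
        μ.real {ω | winsAt S j ω (n + r)} * wordWeight p ((S i).drop r) := by
  rw [← measureReal_inter_occursAt hp0 hp1 hμ (determinedBy_noneBy S n),
    noneBy_inter_occursAt_eq hsub, measureReal_biUnion_finset, Finset.sum_sigma]
  · refine Finset.sum_congr rfl fun j _ => Finset.sum_congr rfl fun r hr => ?_
    obtain ⟨-, -, h, -⟩ := mem_overlaps.1 hr
    rw [← measureReal_inter_occursAt hp0 hp1 hμ (determinedBy_winsAt S j _)]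
    have hlen : n + r + ((S i).drop r).length = n + (S i).length := by
      rw [List.length_drop]; omega
    rw [hlen]
  · rintro ⟨j, r⟩ _ ⟨j', r'⟩ _ hne
    refine Set.disjoint_left.2 fun ω h h' => hne ?_
    obtain ⟨h1, rfl⟩ := winsAt_unique hsub h.1 h'.1
    obtain rfl : r = r' := Nat.add_left_cancel h1
    rfl
  · rintro ⟨j, r⟩ _
    exact (determinedBy_winsAt S j _).measurableSet.inter
      (determinedBy_occursAt _ _).measurableSet

theorem tsum_winsAt_add_eq_X (hz0 : 0 < z) (hz1 : z < 1) {j : Fin m} {r : ℕ}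
    (hr : r ≤ (S j).length) :
    ∑' n, μ.real {ω | winsAt S j ω (n + r)} * z ^ (n + r) = X μ S j z := by
  have hX := summable_measureReal_mul_pow (μ := μ) (fun n => {ω | winsAt S j ω n}) hz0 hz1
  have : X μ S j z = ∑' n, μ.real {ω | winsAt S j ω n} * z ^ n := rfl
  rw [this, ← hX.sum_add_tsum_nat_add r, Finset.sum_eq_zero, zero_add]
  intro l hl
  have h0 : {ω | winsAt S j ω l} = ∅ := by
    ext ω
    simp only [Set.mem_ofPred_eq, Set.mem_empty_iff_false, iff_false]
    rintro ⟨⟨h, -⟩, -⟩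
    have := Finset.mem_range.1 hl
    omega
  rw [h0]
  simp

theorem tsum_noneBy_eq (hp0 : 0 < p) (hp1 : p < 1)
    (hμ : ∀ (n : ℕ) (b : ℕ → Bool),
      μ {ω | ∀ i < n, ω i = b i}
        = ∏ i ∈ Finset.range n, (if b i then ENNReal.ofReal p else ENNReal.ofReal (1 - p)))
    (hsub : ∀ i j, i ≠ j → ¬ S i <:+: S j) (hz0 : 0 < z) (hz1 : z < 1) (i : Fin m) :
    ∑' n, μ.real (noneBy S n) * z ^ n =
      ∑ j, X μ S j z *
        ∑ r ∈ overlaps (S j) (S i), (wordWeight p ((S i).take r) * z ^ r)⁻¹ := by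
  have hsummable : ∀ j r, Summable fun n => μ.real {ω | winsAt S j ω (n + r)} * z ^ (n + r) *
      (wordWeight p ((S i).take r) * z ^ r)⁻¹ := fun j r =>
    ((summable_nat_add_iff r).2
      (summable_measureReal_mul_pow (fun n => {ω | winsAt S j ω n}) hz0 hz1)).mul_right _
  calc
    _ = ∑' n, ∑ j, ∑ r ∈ overlaps (S j) (S i), μ.real {ω | winsAt S j ω (n + r)} * z ^ (n + r) *
          (wordWeight p ((S i).take r) * z ^ r)⁻¹ := by
      refine tsum_congr fun n => ?_
      have hw := wordWeight_pos hp0 hp1 (S i)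
      rw [← mul_right_inj' hw.ne', ← mul_assoc, mul_comm (wordWeight p (S i)),
        measureReal_noneBy_mul hp0 hp1 hμ hsub, Finset.sum_mul, Finset.mul_sum]
      refine Finset.sum_congr rfl fun j _ => ?_
      rw [Finset.sum_mul, Finset.mul_sum]
      refine Finset.sum_congr rfl fun r _ => ?_
      have hw' : wordWeight p (S i) =
          wordWeight p ((S i).take r) * wordWeight p ((S i).drop r) := by
        rw [← wordWeight_append, List.take_append_drop]
      have := (wordWeight_pos hp0 hp1 ((S i).take r)).ne'
      rw [hw', pow_add]
      field_simp
    _ = _ := by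
      rw [Summable.tsum_finsetSum fun j _ => summable_sum fun r _ => hsummable j r]
      refine Finset.sum_congr rfl fun j _ => ?_
      rw [Summable.tsum_finsetSum fun r _ => hsummable j r, Finset.mul_sum]
      refine Finset.sum_congr rfl fun r hr => ?_
      rw [tsum_mul_right, tsum_winsAt_add_eq_X hz0 hz1 (mem_overlaps.1 hr).2.1]

theorem sum_X_mul_overlaps_eq_one (hp0 : 0 < p) (hp1 : p < 1)
    (hμ : ∀ (n : ℕ) (b : ℕ → Bool),
      μ {ω | ∀ i < n, ω i = b i}
        = ∏ i ∈ Finset.range n, (if b i then ENNReal.ofReal p else ENNReal.ofReal (1 - p)))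
    (hS : ∀ i, S i ≠ []) (hsub : ∀ i j, i ≠ j → ¬ S i <:+: S j)
    (hz0 : 0 < z) (hz1 : z < 1) (i : Fin m) :
    ∑ j, X μ S j z * (1 + (1 - z) *
      ∑ r ∈ overlaps (S j) (S i), (wordWeight p ((S i).take r) * z ^ r)⁻¹) = 1 := by
  have h := sum_X_add_eq_one (μ := μ) hS hsub hz0 hz1
  rw [tsum_noneBy_eq hp0 hp1 hμ hsub hz0 hz1 i, Finset.mul_sum, ← Finset.sum_add_distrib] at h
  refine Eq.trans (Finset.sum_congr rfl fun j _ => ?_) h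
  rw [mul_add, mul_one, mul_left_comm]

end Game

theorem firstOcc_eq_coe_iff {S : List Bool} {ω : ℕ → Bool} {n : ℕ} :
    firstOcc S ω = n ↔ occursAt S ω n ∧ ∀ l < n, ¬ occursAt S ω l := by
  classical
  have hback : ∀ k : ℕ, occursAt S ω k → (∀ l < k, ¬ occursAt S ω l) → firstOcc S ω = k := by
    intro k hk hmin
    refine le_antisymm (iInf₂_le k hk) (le_iInf₂ fun l hl => ?_)
    exact Nat.cast_le.2 (not_lt.1 fun h => hmin l h hl)
  refine ⟨fun h => ?_, fun h => hback n h.1 h.2⟩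
  have hex : ∃ k, occursAt S ω k := by
    by_contra hno
    push Not at hno
    simp [firstOcc, hno] at h
  have hfind := hback _ (Nat.find_spec hex) fun l hl => Nat.find_min hex hl
  have : Nat.find hex = n := Nat.cast_injective (hfind.symm.trans h)
  subst this
  exact ⟨Nat.find_spec hex, fun l hl => Nat.find_min hex hl⟩

theorem F_nil (μ : Measure (ℕ → Bool)) [IsProbabilityMeasure μ] (z : ℝ) : F μ [] z = 1 := by
  have h0 : ∀ ω, firstOcc [] ω = ((0 : ℕ) : ℕ∞) := fun ω =>
    firstOcc_eq_coe_iff.2 ⟨by simp [occursAt], by simp⟩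
  rw [F, tsum_eq_single 0]
  · simp [f, h0]
  · intro n hn
    have : ∀ ω, firstOcc [] ω ≠ n := fun ω h => hn (Nat.cast_injective (h.symm.trans (h0 ω)))
    simp [f, this]

theorem X_singleton (μ : Measure (ℕ → Bool)) (C : List Bool) (z : ℝ) :
    X μ (fun _ : Fin 1 => C) 0 z = F μ C z := by
  unfold X F
  refine tsum_congr fun n => ?_
  have : {ω | winsAt (fun _ : Fin 1 => C) 0 ω n} = {ω | firstOcc C ω = n} := by
    ext ω
    simp [winsAt, firstOcc_eq_coe_iff]
  rw [x, f, this]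

theorem F_mul_overlaps_eq_one {p : ℝ} (hp0 : 0 < p) (hp1 : p < 1)
    {μ : Measure (ℕ → Bool)} [IsProbabilityMeasure μ]
    (hμ : ∀ (n : ℕ) (b : ℕ → Bool),
      μ {ω | ∀ i < n, ω i = b i}
        = ∏ i ∈ Finset.range n, (if b i then ENNReal.ofReal p else ENNReal.ofReal (1 - p)))
    {z : ℝ} (hz0 : 0 < z) (hz1 : z < 1) (C : List Bool) :
    F μ C z * (1 + (1 - z) *
      ∑ r ∈ overlaps C C, (wordWeight p (C.take r) * z ^ r)⁻¹) = 1 := by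
  rcases eq_or_ne C [] with rfl | hC
  · simp [F_nil, overlaps]
  · have h := sum_X_mul_overlaps_eq_one (S := fun _ : Fin 1 => C) hp0 hp1 hμ (fun _ => hC)
      (fun i j hij => absurd (Subsingleton.elim i j) hij) hz0 hz1 0
    rwa [Fin.sum_univ_one, X_singleton] at h

theorem stmt10 (p : ℝ) (hp0 : 0 < p) (hp1 : p < 1)
    (μ : Measure (ℕ → Bool)) [IsProbabilityMeasure μ]
    (hμ : ∀ (n : ℕ) (b : ℕ → Bool),
      μ {ω | ∀ i < n, ω i = b i}
        = ∏ i ∈ Finset.range n, (if b i then ENNReal.ofReal p else ENNReal.ofReal (1 - p)))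
    (m : ℕ) (S : Fin m → List Bool) (hS : ∀ i, S i ≠ [])
    (hsub : ∀ i j, i ≠ j → ¬ S i <:+: S j)
    (i : Fin m) (z : ℝ) (hz0 : 0 < z) (hz1 : z < 1) :
    ∑ j : Fin m, X μ S j z / F μ (sqcap (S j) (S i)) z = 1 := by
  rw [← sum_X_mul_overlaps_eq_one hp0 hp1 hμ hS hsub hz0 hz1 i]
  refine Finset.sum_congr rfl fun j _ => ?_
  have hF := F_mul_overlaps_eq_one hp0 hp1 hμ hz0 hz1 (sqcap (S j) (S i))
  rw [overlaps_sqcap_self] at hF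
  rw [div_eq_mul_inv, ← eq_inv_of_mul_eq_one_right hF]
  refine congrArg (fun t => X μ S j z * (1 + (1 - z) * t)) (Finset.sum_congr rfl fun r hr => ?_)
  have hle : r ≤ maxOverlap (S j) (S i) := Finset.le_sup (f := id) hr
  rw [sqcap, List.take_take, min_eq_left hle]
end
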